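/- arXiv:0809.2172 — 4 statements merged into one kernel-verified Lean document; each statement's English description precedes it below -/
import Mathlib

section
/- Let n, m ≥ 1 be integers, x_0 ∈ ℝ^n, R > 0, and let φ ∈ C^{2m}(B_R(x_0)) satisfy Δ^m φ = 0 and φ ≤ 0 on B_R(x_0). If φ(x_0) = 0 and (Δ^i φ)(x_0) = 0 for all i = 1, …, m−1, then φ ≡ 0 on B_R(x_0). -/
open MeasureTheory Metric Filter Set
open scoped ENNReal Topology

/-- The Euclidean Laplacian of `f : ℝ^n → ℝ` (trace of the Hessian, computed as the sum of
second directional derivatives along the standard orthonormal basis). -/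
noncomputable def lap {n : ℕ} (f : EuclideanSpace ℝ (Fin n) → ℝ) :
    EuclideanSpace ℝ (Fin n) → ℝ :=
  fun x => ∑ i : Fin n,
    fderiv ℝ (fun y => fderiv ℝ f y (EuclideanSpace.single i 1)) x (EuclideanSpace.single i 1)

lemma hasDerivAt_max_zero_pow (k : ℕ) (t : ℝ) :
    HasDerivAt (fun s : ℝ => (max 0 s) ^ (k + 2)) ((k + 2) * (max 0 t) ^ (k + 1)) t := by
  rcases lt_trichotomy t 0 with ht | rfl | ht
  · have h : (fun s : ℝ => (max 0 s) ^ (k + 2)) =ᶠ[𝓝 t] fun _ => 0 := by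
      filter_upwards [Iio_mem_nhds ht] with s hs
      simp [max_eq_left (le_of_lt (mem_Iio.1 hs))]
    simpa [max_eq_left ht.le] using (hasDerivAt_const t (0 : ℝ)).congr_of_eventuallyEq h
  · have h : (fun s : ℝ => (max 0 s) ^ (k + 2)) =O[𝓝 0] fun s => s ^ (k + 2) := by
      refine Asymptotics.IsBigO.of_bound 1 (Eventually.of_forall fun s => ?_)
      rw [norm_pow, norm_pow, one_mul]
      refine pow_le_pow_left₀ (norm_nonneg _) ?_ _
      rw [Real.norm_of_nonneg (le_max_left _ _)]
      exact max_le (norm_nonneg _) (le_abs_self s)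
    rw [hasDerivAt_iff_isLittleO_nhds_zero]
    have h2 : (fun s : ℝ => s ^ (k + 2)) =o[𝓝 0] fun s => s := by
      simpa using Asymptotics.isLittleO_pow_pow (𝕜 := ℝ) (show 1 < k + 2 by omega)
    simpa using h.trans_isLittleO h2
  · have h : (fun s : ℝ => (max 0 s) ^ (k + 2)) =ᶠ[𝓝 t] fun s => s ^ (k + 2) := by
      filter_upwards [Ioi_mem_nhds ht] with s hs
      simp [max_eq_right (le_of_lt (mem_Ioi.1 hs))]
    have := (hasDerivAt_pow (k + 2) t).congr_of_eventuallyEq h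
    rw [max_eq_right ht.le]
    simpa using this

/-- The radial weight `(1 - ‖y‖²)₊ ^ k`, supported in the closed unit ball. -/
noncomputable def radialWeight {n : ℕ} (k : ℕ) (y : EuclideanSpace ℝ (Fin n)) : ℝ :=
  (max 0 (1 - ‖y‖ ^ 2)) ^ k

section
variable {n : ℕ}

lemma radialWeight_nonneg (k : ℕ) (y : EuclideanSpace ℝ (Fin n)) : 0 ≤ radialWeight k y :=
  pow_nonneg (le_max_left _ _) _

lemma radialWeight_pos (k : ℕ) {y : EuclideanSpace ℝ (Fin n)} (hy : ‖y‖ < 1) :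
    0 < radialWeight k y :=
  pow_pos (lt_max_of_lt_right (by nlinarith [norm_nonneg y])) _

lemma radialWeight_eq_zero (k : ℕ) {y : EuclideanSpace ℝ (Fin n)} (hy : 1 ≤ ‖y‖) :
    radialWeight (k + 1) y = 0 := by
  rw [radialWeight, max_eq_left (by nlinarith), zero_pow (Nat.succ_ne_zero k)]

lemma continuous_radialWeight (k : ℕ) :
    Continuous (radialWeight k : EuclideanSpace ℝ (Fin n) → ℝ) := by
  unfold radialWeight; fun_prop

lemma hasFDerivAt_radialWeight (k : ℕ) (y : EuclideanSpace ℝ (Fin n)) :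
    HasFDerivAt (radialWeight (k + 2))
      ((-(2 * (k + 2)) * radialWeight (k + 1) y) • innerSL ℝ y) y := by
  have h1 : HasFDerivAt (fun z : EuclideanSpace ℝ (Fin n) => 1 - ‖z‖ ^ 2)
      (-(2 • innerSL ℝ y)) y :=
    ((hasStrictFDerivAt_norm_sq y).hasFDerivAt).const_sub 1
  have h2 := (hasDerivAt_max_zero_pow k (1 - ‖y‖ ^ 2)).comp_hasFDerivAt y h1
  refine h2.congr_fderiv ?_
  ext v
  simp [radialWeight]
  ring

lemma add_smul_mem_ball {x0 y : EuclideanSpace ℝ (Fin n)} {R r : ℝ} (hr : |r| < R)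
    (hy : ‖y‖ ≤ 1) : x0 + r • y ∈ ball x0 R := by
  rw [mem_ball, dist_self_add_left, norm_smul, Real.norm_eq_abs]
  nlinarith [abs_nonneg r, norm_nonneg y]

/-- A function continuous on the closed unit ball times a weight is integrable. -/
lemma integrable_mul_of_continuousOn {g w : EuclideanSpace ℝ (Fin n) → ℝ}
    (hg : ContinuousOn g (closedBall 0 1)) (hw : Continuous w)
    (hw0 : ∀ y, 1 < ‖y‖ → w y = 0) :
    Integrable (fun y => g y * w y) := by
  rw [← integrableOn_iff_integrable_of_support_subset (s := closedBall 0 1)]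
  · exact (hg.mul hw.continuousOn).integrableOn_compact (isCompact_closedBall 0 1)
  · intro y hy
    by_contra h
    refine hy ?_
    simp only [mem_closedBall, dist_zero_right, not_le] at h
    simp [hw0 y h]

lemma continuousOn_comp_add_smul {F : Type*} [TopologicalSpace F]
    {g : EuclideanSpace ℝ (Fin n) → F}
    {x0 : EuclideanSpace ℝ (Fin n)} {R r : ℝ} (hr : |r| < R) (hg : ContinuousOn g (ball x0 R)) :
    ContinuousOn (fun y => g (x0 + r • y)) (closedBall 0 1) :=
  hg.comp (by fun_prop) fun y hy => add_smul_mem_ball hr (by simpa using hy)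

lemma tsupport_radialWeight_subset (k : ℕ) :
    tsupport (radialWeight (k + 1) : EuclideanSpace ℝ (Fin n) → ℝ) ⊆ closedBall 0 1 := by
  refine closure_minimal (fun y hy => ?_) isClosed_closedBall
  by_contra h
  simp only [mem_closedBall, dist_zero_right, not_le] at h
  exact hy (radialWeight_eq_zero k h.le)

/-- The radially weighted integral of `u` over the ball of radius `r` about `x0`, rescaled. -/
noncomputable def weightedMean (k : ℕ) (u : EuclideanSpace ℝ (Fin n) → ℝ)
    (x0 : EuclideanSpace ℝ (Fin n)) (r : ℝ) : ℝ :=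
  ∫ y, u (x0 + r • y) * radialWeight k y

lemma contDiffOn_fderiv_apply {s : Set (EuclideanSpace ℝ (Fin n))} (hs : IsOpen s)
    {u : EuclideanSpace ℝ (Fin n) → ℝ} {p : WithTop ℕ∞} (hu : ContDiffOn ℝ (p + 1) u s)
    (v : EuclideanSpace ℝ (Fin n)) : ContDiffOn ℝ p (fun y => fderiv ℝ u y v) s :=
  (hu.fderiv_of_isOpen hs le_rfl).clm_apply contDiffOn_const

lemma contDiffOn_lap {s : Set (EuclideanSpace ℝ (Fin n))} (hs : IsOpen s)
    {u : EuclideanSpace ℝ (Fin n) → ℝ} {p : WithTop ℕ∞} (hu : ContDiffOn ℝ (p + 1 + 1) u s) :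
    ContDiffOn ℝ p (lap u) s :=
  ContDiffOn.sum fun _ _ => contDiffOn_fderiv_apply hs (contDiffOn_fderiv_apply hs hu _) _

lemma hasDerivAt_weightedMean (k : ℕ) {u : EuclideanSpace ℝ (Fin n) → ℝ}
    {x0 : EuclideanSpace ℝ (Fin n)} {R r : ℝ} (hr : |r| < R) (hu : ContDiffOn ℝ 1 u (ball x0 R)) :
    HasDerivAt (weightedMean (k + 1) u x0)
      (∫ y, fderiv ℝ u (x0 + r • y) y * radialWeight (k + 1) y) r := by
  obtain ⟨ρ, hrρ, hρR⟩ := exists_between hr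
  have hw0 : ∀ y : EuclideanSpace ℝ (Fin n), 1 < ‖y‖ → radialWeight (k + 1) y = 0 :=
    fun y hy => radialWeight_eq_zero k hy.le
  have hwc := continuous_radialWeight (n := n) (k + 1)
  have hdu : ContinuousOn (fderiv ℝ u) (ball x0 R) :=
    hu.continuousOn_fderiv_of_isOpen isOpen_ball le_rfl
  have hs : {t : ℝ | |t| < ρ} ∈ 𝓝 r := (isOpen_lt continuous_abs continuous_const).mem_nhds hrρ
  obtain ⟨C, hC⟩ := (isCompact_closedBall x0 ρ).exists_bound_of_continuousOn
    (hdu.mono (closedBall_subset_ball hρR))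
  refine (hasDerivAt_integral_of_dominated_loc_of_deriv_le
    (F' := fun t y => fderiv ℝ u (x0 + t • y) y * radialWeight (k + 1) y)
    (bound := fun y => C * radialWeight (k + 1) y) hs ?_ ?_ ?_ ?_ ?_ ?_).2
  · filter_upwards [hs] with t ht
    exact (integrable_mul_of_continuousOn
      (continuousOn_comp_add_smul (lt_trans ht hρR) hu.continuousOn) hwc hw0).aestronglyMeasurable
  · exact integrable_mul_of_continuousOn (continuousOn_comp_add_smul hr hu.continuousOn) hwc hw0
  · exact (integrable_mul_of_continuousOn ((continuousOn_comp_add_smul hr hdu).clm_apply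
      continuousOn_id) hwc hw0).aestronglyMeasurable
  · refine Eventually.of_forall fun y t ht => ?_
    rcases le_or_gt ‖y‖ 1 with hy | hy
    · rw [norm_mul, Real.norm_of_nonneg (radialWeight_nonneg _ _)]
      refine mul_le_mul_of_nonneg_right ?_ (radialWeight_nonneg _ _)
      have h1 := hC (x0 + t • y) (ball_subset_closedBall (add_smul_mem_ball ht hy))
      calc ‖fderiv ℝ u (x0 + t • y) y‖ ≤ ‖fderiv ℝ u (x0 + t • y)‖ * ‖y‖ :=
            ContinuousLinearMap.le_opNorm _ _
        _ ≤ ‖fderiv ℝ u (x0 + t • y)‖ := mul_le_of_le_one_right (norm_nonneg _) hy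
        _ ≤ C := h1
    · simp [hw0 y hy]
  · exact integrable_mul_of_continuousOn continuousOn_const hwc hw0
  · refine Eventually.of_forall fun y t ht => ?_
    rcases le_or_gt ‖y‖ 1 with hy | hy
    · have h1 : HasFDerivAt u (fderiv ℝ u (x0 + t • y)) (x0 + t • y) :=
        ((hu.differentiableOn one_ne_zero).differentiableAt
          (isOpen_ball.mem_nhds (add_smul_mem_ball (lt_trans ht hρR) hy))).hasFDerivAt
      have h2 : HasDerivAt (fun s : ℝ => x0 + s • y) y t := by
        simpa using ((hasDerivAt_id t).smul_const y).const_add x0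
      exact (h1.comp_hasDerivAt t h2).mul_const _
    · simpa [hw0 y hy] using hasDerivAt_const t (0 : ℝ)

lemma integral_comp_add_smul_mul_radialWeight (k : ℕ) {g : EuclideanSpace ℝ (Fin n) → ℝ}
    {x0 : EuclideanSpace ℝ (Fin n)} {R r : ℝ} (hr : |r| < R) (hg : ContDiffOn ℝ 1 g (ball x0 R))
    (i : Fin n) :
    ∫ y, g (x0 + r • y) * (y i * radialWeight (k + 1) y) =
      r / (2 * (k + 2)) * ∫ y, fderiv ℝ g (x0 + r • y) (EuclideanSpace.single i 1) *
        radialWeight (k + 2) y := by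
  have hw0 : ∀ l, ∀ y : EuclideanSpace ℝ (Fin n), 1 < ‖y‖ → radialWeight (l + 1) y = 0 :=
    fun l y hy => radialWeight_eq_zero l hy.le
  have hdg : ContinuousOn (fderiv ℝ g) (ball x0 R) :=
    hg.continuousOn_fderiv_of_isOpen isOpen_ball le_rfl
  have hk : (2 * ((k : ℝ) + 2)) ≠ 0 := by positivity
  have hderiv : ∀ y : EuclideanSpace ℝ (Fin n),
      ((-(2 * ((k : ℝ) + 2)) * radialWeight (k + 1) y) • innerSL ℝ y)
        (EuclideanSpace.single i 1) =
      -(2 * ((k : ℝ) + 2)) * (y i * radialWeight (k + 1) y) := fun y => by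
    simp [EuclideanSpace.inner_single_right]; ring
  have key := integral_bilinear_hasFDerivAt_right_eq_neg_left_of_integrable
    (μ := (volume : Measure (EuclideanSpace ℝ (Fin n))))
    (f := fun y => g (x0 + r • y)) (f' := fun y => r • fderiv ℝ g (x0 + r • y))
    (g := radialWeight (k + 2))
    (g' := fun y => (-(2 * ((k : ℝ) + 2)) * radialWeight (k + 1) y) • innerSL ℝ y)
    (v := EuclideanSpace.single i 1) (B := ContinuousLinearMap.mul ℝ ℝ)
    ?_ ?_ ?_ ?_ (fun y _ => hasFDerivAt_radialWeight k y)
  · have hl : ∀ y : EuclideanSpace ℝ (Fin n),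
        g (x0 + r • y) * (-(2 * ((k : ℝ) + 2)) * (y i * radialWeight (k + 1) y)) =
        -(2 * ((k : ℝ) + 2)) * (g (x0 + r • y) * (y i * radialWeight (k + 1) y)) :=
      fun y => mul_left_comm _ _ _
    simp only [ContinuousLinearMap.mul_apply', hderiv, smul_apply, smul_eq_mul, mul_assoc r,
      hl, integral_const_mul] at key
    rw [div_mul_eq_mul_div, eq_div_iff hk]
    linarith
  · simp only [ContinuousLinearMap.mul_apply']
    exact integrable_mul_of_continuousOn
      (((continuousOn_comp_add_smul hr hdg).const_smul r).clm_apply continuousOn_const)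
      (continuous_radialWeight _) (hw0 _)
  · simp only [ContinuousLinearMap.mul_apply', hderiv]
    refine integrable_mul_of_continuousOn (continuousOn_comp_add_smul hr hg.continuousOn)
      ?_ fun y hy => by simp [hw0 k y hy]
    have := continuous_radialWeight (n := n) (k + 1)
    fun_prop
  · simp only [ContinuousLinearMap.mul_apply']
    exact integrable_mul_of_continuousOn (continuousOn_comp_add_smul hr hg.continuousOn)
      (continuous_radialWeight _) (hw0 _)
  · intro y hy
    have hy1 : ‖y‖ ≤ 1 := by simpa using tsupport_radialWeight_subset (k + 1) hy
    have h1 : HasFDerivAt g (fderiv ℝ g (x0 + r • y)) (x0 + r • y) :=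
      ((hg.differentiableOn one_ne_zero).differentiableAt
        (isOpen_ball.mem_nhds (add_smul_mem_ball hr hy1))).hasFDerivAt
    have h2 : HasFDerivAt (fun z => x0 + r • z)
        (r • ContinuousLinearMap.id ℝ (EuclideanSpace ℝ (Fin n))) y :=
      ((hasFDerivAt_id y).const_smul r).const_add x0
    refine (h1.comp y h2).congr_fderiv ?_
    ext v; simp

lemma integral_fderiv_mul_radialWeight (k : ℕ) {u : EuclideanSpace ℝ (Fin n) → ℝ}
    {x0 : EuclideanSpace ℝ (Fin n)} {R r : ℝ} (hr : |r| < R)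
    (hu : ContDiffOn ℝ (1 + 1) u (ball x0 R)) :
    ∫ y, fderiv ℝ u (x0 + r • y) y * radialWeight (k + 1) y =
      r / (2 * (k + 2)) * weightedMean (k + 2) (lap u) x0 r := by
  have hg : ∀ i : Fin n, ContDiffOn ℝ 1
      (fun z => fderiv ℝ u z (EuclideanSpace.single i 1)) (ball x0 R) :=
    fun i => contDiffOn_fderiv_apply isOpen_ball hu _
  have hexp : ∀ (L : EuclideanSpace ℝ (Fin n) →L[ℝ] ℝ) (y : EuclideanSpace ℝ (Fin n)),
      L y = ∑ i, L (EuclideanSpace.single i 1) * y i := fun L y => by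
    conv_lhs => rw [← (EuclideanSpace.basisFun (Fin n) ℝ).sum_repr y]
    simp [mul_comm]
  simp only [fun y => hexp (fderiv ℝ u (x0 + r • y)) y, weightedMean, lap, Finset.sum_mul, mul_assoc]
  rw [integral_finsetSum, integral_finsetSum, Finset.mul_sum]
  · exact Finset.sum_congr rfl fun i _ =>
      integral_comp_add_smul_mul_radialWeight k hr (hg i) i
  · intro i _
    exact integrable_mul_of_continuousOn (continuousOn_comp_add_smul hr
      (((hg i).continuousOn_fderiv_of_isOpen isOpen_ball le_rfl).clm_apply continuousOn_const))
      (continuous_radialWeight _) fun y hy => radialWeight_eq_zero _ hy.le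
  · intro i _
    refine integrable_mul_of_continuousOn (continuousOn_comp_add_smul hr (hg i).continuousOn)
      ?_ fun y hy => by simp [radialWeight_eq_zero k hy.le]
    have := continuous_radialWeight (n := n) (k + 1)
    fun_prop

/-- If `u` is polyharmonic and all its iterated Laplacians vanish at `x0`, then so do all its
radially weighted means about `x0`. -/
lemma weightedMean_eq_zero_of_iterate_lap (m : ℕ) : ∀ (k : ℕ)
    {u : EuclideanSpace ℝ (Fin n) → ℝ} {x0 : EuclideanSpace ℝ (Fin n)} {R r : ℝ}, |r| < R →
    ContDiffOn ℝ (2 * m) u (ball x0 R) → (∀ x ∈ ball x0 R, lap^[m] u x = 0) →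
    (∀ i < m, lap^[i] u x0 = 0) → weightedMean (k + 1) u x0 r = 0 := by
  induction m with
  | zero =>
    intro k u x0 R r hr _ h _
    have : ∀ y, u (x0 + r • y) * radialWeight (k + 1) y = 0 := fun y => by
      rcases le_or_gt ‖y‖ 1 with hy | hy
      · have := h _ (add_smul_mem_ball hr hy)
        simp_all
      · rw [radialWeight_eq_zero k hy.le, mul_zero]
    simp [weightedMean, this]
  | succ m ih =>
    intro k u x0 R r hr hu h h0
    have hu' : ContDiffOn ℝ (2 * m + 1 + 1) u (ball x0 R) := by
      refine hu.of_le (le_of_eq ?_)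
      norm_cast
    have hu2 : ContDiffOn ℝ (1 + 1) u (ball x0 R) :=
      hu'.of_le (by gcongr; exact le_add_of_nonneg_left zero_le)
    have hd : ∀ t ∈ Ioo (-R) R, HasDerivAt (weightedMean (k + 1) u x0) 0 t := fun t ht => by
      have ht' := abs_lt.2 ht
      have h1 := hasDerivAt_weightedMean k ht' (hu2.of_le le_self_add)
      rwa [integral_fderiv_mul_radialWeight k ht' hu2, ih (k + 1) ht'
        (contDiffOn_lap isOpen_ball hu') h fun i hi => h0 (i + 1) (by omega), mul_zero] at h1
    have hR : 0 < R := (abs_nonneg r).trans_lt hr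
    rw [isOpen_Ioo.is_const_of_deriv_eq_zero isPreconnected_Ioo
      (fun t ht => (hd t ht).differentiableAt.differentiableWithinAt) (fun t ht => (hd t ht).deriv)
      (abs_lt.1 hr) (show (0 : ℝ) ∈ Ioo (-R) R by simp [hR])]
    have h00 : u x0 = 0 := h0 0 (by omega)
    simp [weightedMean, h00]

end

theorem stmt_12 (n m : ℕ) (hn : 1 ≤ n) (hm : 1 ≤ m)
    (x0 : EuclideanSpace ℝ (Fin n)) (R : ℝ) (hR : 0 < R)
    (φ : EuclideanSpace ℝ (Fin n) → ℝ)
    (hφ : ContDiffOn ℝ (2*m) φ (ball x0 R))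
    (hph : ∀ x ∈ ball x0 R, lap^[m] φ x = 0)
    (hneg : ∀ x ∈ ball x0 R, φ x ≤ 0)
    (h0 : φ x0 = 0)
    (hΔ0 : ∀ i, 1 ≤ i → i ≤ m - 1 → lap^[i] φ x0 = 0) :
    ∀ x ∈ ball x0 R, φ x = 0 := by
  intro x hx
  rw [mem_ball, dist_eq_norm] at hx
  obtain ⟨r, hxr, hrR⟩ := exists_between hx
  have hr0 : 0 < r := (norm_nonneg _).trans_lt hxr
  have hr : |r| < R := by rwa [abs_of_pos hr0]
  have hmean : weightedMean 1 φ x0 r = 0 :=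
    weightedMean_eq_zero_of_iterate_lap m 0 hr hφ hph fun i hi => by
      rcases Nat.eq_zero_or_pos i with rfl | hi0
      · exact h0
      · exact hΔ0 i hi0 (by omega)
  have hc := continuousOn_comp_add_smul hr hφ.continuousOn
  have hint : Integrable (fun y => φ (x0 + r • y) * radialWeight 1 y) :=
    integrable_mul_of_continuousOn hc (continuous_radialWeight 1)
      fun y hy => radialWeight_eq_zero 0 hy.le
  have hnonneg : 0 ≤ fun y => -(φ (x0 + r • y) * radialWeight 1 y) := fun y => by
    rcases le_or_gt ‖y‖ 1 with hy | hy
    · exact neg_nonneg.2 (mul_nonpos_of_nonpos_of_nonneg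
        (hneg _ (add_smul_mem_ball hr hy)) (radialWeight_nonneg _ _))
    · simp [radialWeight_eq_zero 0 hy.le]
  have hae := (integral_eq_zero_iff_of_nonneg hnonneg hint.neg).1
    (by rw [integral_neg, neg_eq_zero]; exact hmean)
  have heq := Measure.eqOn_open_of_ae_eq (U := ball 0 1) (ae_restrict_of_ae hae) isOpen_ball
    ((hc.mono ball_subset_closedBall).mul (continuous_radialWeight 1).continuousOn).neg
    continuousOn_const
  have hy : ‖r⁻¹ • (x - x0)‖ < 1 := by
    rw [norm_smul, norm_inv, Real.norm_of_nonneg hr0.le, inv_mul_lt_one₀ hr0]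
    exact hxr
  have hz := heq (show r⁻¹ • (x - x0) ∈ ball 0 1 by simpa using hy)
  simpa [smul_inv_smul₀ hr0.ne', (radialWeight_pos 1 hy).ne'] using hz
end

section
/- Standard solutions of the Liouville equation: for every integer m ≥ 1, every λ > 0 and every x_0 ∈ ℝ^{2m}, the function u(x) := log( 2λ / (1 + λ²|x−x_0|²) ) is smooth on ℝ^{2m} and satisfies (−Δ)^m u = (2m−1)! · e^{2m u} at every point of ℝ^{2m}. -/
open MeasureTheory Metric Filter Set
open scoped ENNReal Topology

/-- The family `-log t, 1/t, 1/t², 2/t³, …`; each member is minus the derivative of the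
preceding one on `(0, ∞)`. -/
noncomputable def negLogPow : ℕ → ℝ → ℝ
  | 0, t => -Real.log t
  | k + 1, t => (k.factorial : ℝ) * (t ^ (k + 1))⁻¹

theorem hasDerivAt_negLogPow (k : ℕ) {t : ℝ} (ht : 0 < t) :
    HasDerivAt (negLogPow k) (-negLogPow (k + 1) t) t := by
  cases k with
  | zero =>
    change HasDerivAt (fun t => -Real.log t) _ t
    refine (Real.hasDerivAt_log ht.ne').fun_neg.congr_deriv ?_
    simp [negLogPow]
  | succ k =>
    change HasDerivAt (fun t => (k.factorial : ℝ) * (t ^ (k + 1))⁻¹) _ t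
    have h := ((hasDerivAt_pow (k + 1) t).fun_inv (pow_ne_zero _ ht.ne')).const_mul
      (k.factorial : ℝ)
    refine h.congr_deriv ?_
    simp only [negLogPow, Nat.factorial_succ]
    push_cast
    have := ht.ne'
    field_simp
    ring

theorem mul_negLogPow_add_two (k : ℕ) {t : ℝ} (ht : 0 < t) :
    t * negLogPow (k + 2) t = (k + 1) * negLogPow (k + 1) t := by
  have := ht.ne'
  simp only [negLogPow, Nat.factorial_succ]
  push_cast
  field_simp
  ring

/-- The Laplacian of a function of `1 + a² ‖x - x₀‖²`. -/
theorem lap_comp_one_add_sq {n : ℕ} (a : ℝ) (x0 : EuclideanSpace ℝ (Fin n)) {g g' g'' : ℝ → ℝ}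
    (hg : ∀ t, 0 < t → HasDerivAt g (g' t) t) (hg' : ∀ t, 0 < t → HasDerivAt g' (g'' t) t)
    (x : EuclideanSpace ℝ (Fin n)) :
    lap (fun y => g (1 + a ^ 2 * ‖y - x0‖ ^ 2)) x =
      4 * a ^ 2 * (a ^ 2 * ‖x - x0‖ ^ 2) * g'' (1 + a ^ 2 * ‖x - x0‖ ^ 2) +
        2 * n * a ^ 2 * g' (1 + a ^ 2 * ‖x - x0‖ ^ 2) := by
  have hpos (y : EuclideanSpace ℝ (Fin n)) : 0 < 1 + a ^ 2 * ‖y - x0‖ ^ 2 := by positivity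
  have hw (y : EuclideanSpace ℝ (Fin n)) :
      HasFDerivAt (fun y => 1 + a ^ 2 * ‖y - x0‖ ^ 2)
        ((2 * a ^ 2) • innerSL ℝ (y - x0)) y := by
    have h := ((((hasFDerivAt_id y).sub_const x0).norm_sq).const_mul (a ^ 2)).const_add 1
    refine h.congr_fderiv ?_
    ext v
    simp
    ring
  have hcomp {h h' : ℝ → ℝ} (hh : ∀ t, 0 < t → HasDerivAt h (h' t) t)
      (y : EuclideanSpace ℝ (Fin n)) :=
    (hh _ (hpos y)).comp_hasFDerivAt y (hw y)
  have hfst (y : EuclideanSpace ℝ (Fin n)) (i : Fin n) :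
      fderiv ℝ (fun y => g (1 + a ^ 2 * ‖y - x0‖ ^ 2)) y (EuclideanSpace.single i 1) =
        g' (1 + a ^ 2 * ‖y - x0‖ ^ 2) * (2 * a ^ 2 * (y i - x0 i)) := by
    rw [show fderiv ℝ (fun y => g (1 + a ^ 2 * ‖y - x0‖ ^ 2)) y = _ from (hcomp hg y).fderiv]
    simp [EuclideanSpace.inner_single_right]
  have hsnd (i : Fin n) :
      fderiv ℝ (fun y => g' (1 + a ^ 2 * ‖y - x0‖ ^ 2) * (2 * a ^ 2 * (y i - x0 i))) x
        (EuclideanSpace.single i 1) =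
      4 * a ^ 4 * g'' (1 + a ^ 2 * ‖x - x0‖ ^ 2) * (x i - x0 i) ^ 2 +
        2 * a ^ 2 * g' (1 + a ^ 2 * ‖x - x0‖ ^ 2) := by
    have hlin : HasFDerivAt (fun y : EuclideanSpace ℝ (Fin n) => 2 * a ^ 2 * (y i - x0 i))
        ((2 * a ^ 2) • EuclideanSpace.proj (𝕜 := ℝ) i) x :=
      ((EuclideanSpace.proj (𝕜 := ℝ) i).hasFDerivAt.sub_const (x0 i)).const_mul (2 * a ^ 2)
    rw [show fderiv ℝ (fun y => g' (1 + a ^ 2 * ‖y - x0‖ ^ 2) * (2 * a ^ 2 * (y i - x0 i))) x = _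
      from ((hcomp hg' x).mul hlin).fderiv]
    simp [EuclideanSpace.inner_single_right]
    ring
  simp only [lap, hfst, hsnd]
  rw [Finset.sum_add_distrib, ← Finset.mul_sum, EuclideanSpace.real_norm_sq_eq]
  simp
  ring

/-- The coefficients in the expansion of the iterated Laplacian of `-log (1 + a² ‖x - x₀‖²)`. -/
noncomputable def lapCoeff (m j i : ℕ) : ℝ :=
  j.choose i * ∏ l ∈ Finset.Ico (i + 1) (j + 1), ((m : ℝ) - l)

theorem lapCoeff_zero_succ (m j : ℕ) :
    lapCoeff m (j + 1) 0 = (m - 1 - j) * lapCoeff m j 0 := by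
  simp only [lapCoeff, Nat.choose_zero_right]
  rw [Finset.prod_Ico_succ_top (by omega)]
  push_cast
  ring

theorem lapCoeff_of_lt (m : ℕ) {j i : ℕ} (h : j < i) : lapCoeff m j i = 0 := by
  simp [lapCoeff, Nat.choose_eq_zero_of_lt h]

theorem lapCoeff_succ_succ (m : ℕ) {j i : ℕ} (hij : i ≤ j) :
    lapCoeff m (j + 1) (i + 1) =
      (m - 1 - (j + (i + 1))) * lapCoeff m j (i + 1) + lapCoeff m j i := by
  rcases hij.eq_or_lt with rfl | hlt
  · simp [lapCoeff]
  · simp only [lapCoeff]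
    rw [Finset.prod_Ico_succ_top (by omega : i + 1 + 1 ≤ j + 1),
      Finset.prod_eq_prod_Ico_succ_bot (by omega : i + 1 < j + 1), Nat.choose_succ_succ]
    have h : (j.choose (i + 1) : ℝ) * (i + 1) = j.choose i * (j - i) := by
      have := Nat.choose_succ_right_eq j i
      rw [← Nat.cast_sub hij]
      exact_mod_cast this
    push_cast
    linear_combination (∏ l ∈ Finset.Ico (i + 1 + 1) (j + 1), ((m : ℝ) - l)) * h

theorem lapCoeff_self (m i : ℕ) : lapCoeff m m i = if i = m then 1 else 0 := by
  split_ifs with h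
  · simp [h, lapCoeff]
  · rcases lt_or_gt_of_ne h with h | h
    · have : ∏ l ∈ Finset.Ico (i + 1) (m + 1), ((m : ℝ) - l) = 0 :=
        Finset.prod_eq_zero (i := m) (by simp; omega) (by simp)
      simp [lapCoeff, this]
    · exact lapCoeff_of_lt m h

theorem sum_lapCoeff_succ (m j : ℕ) (b : ℕ → ℝ) :
    ∑ i ∈ Finset.range (j + 2), lapCoeff m (j + 1) i * b (j + 1 + i) =
      ∑ i ∈ Finset.range (j + 1),
        lapCoeff m j i * ((m - 1 - (j + i)) * b (j + i + 1) + b (j + i + 2)) := by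
  have hshift : ∑ i ∈ Finset.range (j + 1), lapCoeff m j i * ((m - 1 - (j + i)) * b (j + i + 1)) =
      ∑ i ∈ Finset.range (j + 2), lapCoeff m j i * ((m - 1 - (j + i)) * b (j + i + 1)) := by
    rw [Finset.sum_range_succ _ (j + 1), lapCoeff_of_lt m (Nat.lt_succ_self j)]
    simp
  simp only [mul_add (lapCoeff m j _)]
  rw [Finset.sum_add_distrib, hshift, Finset.sum_range_succ' _ (j + 1),
    Finset.sum_range_succ' _ (j + 1), lapCoeff_zero_succ, add_right_comm (Finset.sum _ _), ← Finset.sum_add_distrib]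
  congr 1
  · refine Finset.sum_congr rfl fun i hi => ?_
    rw [lapCoeff_succ_succ m (Nat.lt_succ_iff.mp (Finset.mem_range.mp hi)),
      show j + 1 + (i + 1) = j + i + 2 by ring, show j + (i + 1) + 1 = j + i + 2 by ring]
    push_cast
    ring
  · simp
    ring

theorem iterate_lap_negLog (m j : ℕ) (a : ℝ) (x0 : EuclideanSpace ℝ (Fin (2 * m))) :
    lap^[j] (fun x => -Real.log (1 + a ^ 2 * ‖x - x0‖ ^ 2)) = fun x =>
      (-(4 * a ^ 2)) ^ j * ∑ i ∈ Finset.range (j + 1),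
        lapCoeff m j i * negLogPow (j + i) (1 + a ^ 2 * ‖x - x0‖ ^ 2) := by
  induction j with
  | zero => simp [lapCoeff, negLogPow]
  | succ j ih =>
    rw [Function.iterate_succ_apply', ih]
    funext x
    have h1 (t : ℝ) (ht : 0 < t) :=
      (HasDerivAt.fun_sum fun i (_ : i ∈ Finset.range (j + 1)) =>
        (hasDerivAt_negLogPow (j + i) ht).const_mul (lapCoeff m j i)).const_mul
          ((-(4 * a ^ 2)) ^ j)
    have h2 (t : ℝ) (ht : 0 < t) :=
      (HasDerivAt.fun_sum fun i (_ : i ∈ Finset.range (j + 1)) =>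
        (hasDerivAt_negLogPow (j + i + 1) ht).fun_neg.const_mul (lapCoeff m j i)).const_mul
          ((-(4 * a ^ 2)) ^ j)
    rw [lap_comp_one_add_sq a x0 h1 h2 x]
    have hpos : 0 < 1 + a ^ 2 * ‖x - x0‖ ^ 2 := by positivity
    obtain ⟨t, ht⟩ : ∃ t, t = 1 + a ^ 2 * ‖x - x0‖ ^ 2 := ⟨_, rfl⟩
    rw [← ht] at hpos ⊢
    rw [show a ^ 2 * ‖x - x0‖ ^ 2 = t - 1 by rw [ht]; ring,
      sum_lapCoeff_succ m j fun k => negLogPow k t]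
    simp only [Finset.mul_sum]
    rw [← Finset.sum_add_distrib]
    refine Finset.sum_congr rfl fun i _ => ?_
    have h := mul_negLogPow_add_two (j + i) hpos
    push_cast at h ⊢
    rw [show j + i + 1 + 1 = j + i + 2 by ring]
    linear_combination (4 * a ^ 2 * (-(4 * a ^ 2)) ^ j * lapCoeff m j i) * h

theorem iterate_lap_const_add {n j : ℕ} (hj : 1 ≤ j) (c : ℝ)
    (f : EuclideanSpace ℝ (Fin n) → ℝ) :
    lap^[j] (fun x => c + f x) = lap^[j] f := by
  obtain ⟨k, rfl⟩ := Nat.exists_eq_add_of_le' hj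
  rw [Function.iterate_succ_apply, Function.iterate_succ_apply]
  congr 1
  funext x
  simp only [lap, fderiv_const_add]

theorem stmt_14 (m : ℕ) (hm : 1 ≤ m) (lam : ℝ) (hlam : 0 < lam)
    (x0 : EuclideanSpace ℝ (Fin (2*m))) :
    ContDiff ℝ (⊤ : ℕ∞)
      (fun x : EuclideanSpace ℝ (Fin (2*m)) =>
        Real.log (2 * lam / (1 + lam^2 * ‖x - x0‖^2))) ∧
    ∀ x : EuclideanSpace ℝ (Fin (2*m)),
      (-1 : ℝ)^m * lap^[m]
          (fun x => Real.log (2 * lam / (1 + lam^2 * ‖x - x0‖^2))) x =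
        (2*m-1).factorial *
          Real.exp (2*m * Real.log (2 * lam / (1 + lam^2 * ‖x - x0‖^2))) := by
  have hpos (x : EuclideanSpace ℝ (Fin (2 * m))) : 0 < 1 + lam ^ 2 * ‖x - x0‖ ^ 2 := by positivity
  refine ⟨?_, fun x => ?_⟩
  · refine ContDiff.log (contDiff_const.div ?_ fun x => (hpos x).ne') fun x =>
      (div_pos (by positivity) (hpos x)).ne'
    exact contDiff_const.add (contDiff_const.mul ((contDiff_id.sub contDiff_const).norm_sq ℝ))
  · have hlog : (fun x : EuclideanSpace ℝ (Fin (2 * m)) =>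
        Real.log (2 * lam / (1 + lam ^ 2 * ‖x - x0‖ ^ 2))) =
        fun x => Real.log (2 * lam) + -Real.log (1 + lam ^ 2 * ‖x - x0‖ ^ 2) := by
      funext y
      rw [Real.log_div (by positivity) (hpos y).ne', sub_eq_add_neg]
    have hiter : lap^[m] (fun x => Real.log (2 * lam / (1 + lam ^ 2 * ‖x - x0‖ ^ 2))) =
        lap^[m] (fun x => -Real.log (1 + lam ^ 2 * ‖x - x0‖ ^ 2)) := by
      rw [hlog, iterate_lap_const_add hm]
    have hexp : Real.exp (2 * m * Real.log (2 * lam / (1 + lam ^ 2 * ‖x - x0‖ ^ 2))) =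
        (2 * lam / (1 + lam ^ 2 * ‖x - x0‖ ^ 2)) ^ (2 * m) := by
      rw [show (2 * m : ℝ) = ((2 * m : ℕ) : ℝ) by push_cast; rfl, Real.exp_nat_mul,
        Real.exp_log (div_pos (by positivity) (hpos x))]
    have hnegLogPow (t : ℝ) : negLogPow (m + m) t = (2 * m - 1).factorial * (t ^ (2 * m))⁻¹ := by
      rw [show m + m = (2 * m - 1) + 1 by omega, negLogPow, show 2 * m - 1 + 1 = 2 * m by omega]
    rw [hiter, hexp, iterate_lap_negLog]
    simp only [lapCoeff_self, ite_mul, one_mul, zero_mul]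
    rw [Finset.sum_ite_eq', if_pos (Finset.self_mem_range_succ m), hnegLogPow, ← mul_assoc,
      ← mul_pow, div_pow, pow_mul (2 * lam)]
    ring
end

section
/- Fundamental solution of (−Δ)^m on ℝ^{2m}: for every integer m ≥ 1 and every compactly supported smooth function φ : ℝ^{2m} → ℝ, one has (−1)^m ∫_{ℝ^{2m}} log(1/|x|) · (Δ^m φ)(x) dx = γ_m · φ(0), where γ_m = 2^{2m−1} π^m (m−1)!. Equivalently, the function −(1/γ_m) log|x| satisfies (−Δ)^m( −(1/γ_m) log|x| ) = δ_0 in the sense of distributions on ℝ^{2m}. -/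
open MeasureTheory Metric Filter Set
open scoped ENNReal Topology

section Laplacian

variable {n : ℕ} {f g : EuclideanSpace ℝ (Fin n) → ℝ}

theorem contDiff_fderiv_apply (hf : ContDiff ℝ (⊤ : ℕ∞) f) (v : EuclideanSpace ℝ (Fin n)) :
    ContDiff ℝ (⊤ : ℕ∞) fun y => fderiv ℝ f y v :=
  (hf.fderiv_right (by simp)).clm_apply contDiff_const

theorem contDiff_lap (hf : ContDiff ℝ (⊤ : ℕ∞) f) : ContDiff ℝ (⊤ : ℕ∞) (lap f) :=
  ContDiff.sum fun _ _ => contDiff_fderiv_apply (contDiff_fderiv_apply hf _) _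

theorem hasCompactSupport_lap (hf : HasCompactSupport f) : HasCompactSupport (lap f) := by
  refine HasCompactSupport.intro hf fun x hx => Finset.sum_eq_zero fun i _ => ?_
  have h1 := tsupport_fderiv_apply_subset ℝ (f := f) (EuclideanSpace.single i 1)
  have h2 := tsupport_fderiv_apply_subset ℝ
    (f := fun y => fderiv ℝ f y (EuclideanSpace.single i 1)) (EuclideanSpace.single i 1)
  exact image_eq_zero_of_notMem_tsupport
    (f := fun x => fderiv ℝ (fun y => fderiv ℝ f y (EuclideanSpace.single i 1)) x
      (EuclideanSpace.single i 1)) fun h => hx (h1 (h2 h))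

theorem contDiff_iterate_lap (hf : ContDiff ℝ (⊤ : ℕ∞) f) (j : ℕ) :
    ContDiff ℝ (⊤ : ℕ∞) (lap^[j] f) := by
  induction j with
  | zero => exact hf
  | succ j ih => rw [Function.iterate_succ_apply']; exact contDiff_lap ih

theorem hasCompactSupport_iterate_lap (hf : HasCompactSupport f) (j : ℕ) :
    HasCompactSupport (lap^[j] f) := by
  induction j with
  | zero => exact hf
  | succ j ih => rw [Function.iterate_succ_apply']; exact hasCompactSupport_lap ih

theorem integral_mul_fderiv_apply (hf : ContDiff ℝ (⊤ : ℕ∞) f) (hg : ContDiff ℝ (⊤ : ℕ∞) g)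
    (hgc : HasCompactSupport g) (v : EuclideanSpace ℝ (Fin n)) :
    ∫ x, f x * fderiv ℝ g x v = -∫ x, fderiv ℝ f x v * g x := by
  have hfv := (contDiff_fderiv_apply hf v).continuous
  have hgv := (contDiff_fderiv_apply hg v).continuous
  have hgvc : HasCompactSupport fun x => fderiv ℝ g x v := hgc.fderiv_apply ℝ v
  refine integral_mul_fderiv_eq_neg_fderiv_mul_of_integrable
    ((hfv.mul hg.continuous).integrable_of_hasCompactSupport hgc.mul_left)
    ((hf.continuous.mul hgv).integrable_of_hasCompactSupport hgvc.mul_left)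
    ((hf.continuous.mul hg.continuous).integrable_of_hasCompactSupport hgc.mul_left)
    (fun x _ => hf.differentiable (by simp) x) (fun x _ => hg.differentiable (by simp) x)

theorem integral_mul_lap (hf : ContDiff ℝ (⊤ : ℕ∞) f) (hg : ContDiff ℝ (⊤ : ℕ∞) g)
    (hgc : HasCompactSupport g) :
    ∫ x, f x * lap g x = ∫ x, lap f x * g x := by
  simp only [lap, Finset.mul_sum, Finset.sum_mul]
  rw [integral_finsetSum, integral_finsetSum]
  · refine Finset.sum_congr rfl fun i _ => ?_
    have hgv := contDiff_fderiv_apply hg (EuclideanSpace.single i 1)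
    have hfv := contDiff_fderiv_apply hf (EuclideanSpace.single i 1)
    rw [integral_mul_fderiv_apply hf hgv (hgc.fderiv_apply ℝ _),
      integral_mul_fderiv_apply hfv hg hgc, neg_neg]
  · intro i _
    exact ((contDiff_fderiv_apply (contDiff_fderiv_apply hf _) _).continuous.mul
      hg.continuous).integrable_of_hasCompactSupport hgc.mul_left
  · intro i _
    have hgvc : HasCompactSupport fun x => fderiv ℝ (fun y => fderiv ℝ g y
        (EuclideanSpace.single i 1)) x (EuclideanSpace.single i 1) :=
      (hgc.fderiv_apply ℝ _).fderiv_apply ℝ _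
    exact (hf.continuous.mul (contDiff_fderiv_apply
      (contDiff_fderiv_apply hg _) _).continuous).integrable_of_hasCompactSupport hgvc.mul_left

theorem integral_mul_iterate_lap (hf : ContDiff ℝ (⊤ : ℕ∞) f) (hg : ContDiff ℝ (⊤ : ℕ∞) g)
    (hgc : HasCompactSupport g) (j : ℕ) :
    ∫ x, f x * lap^[j] g x = ∫ x, lap^[j] f x * g x := by
  induction j generalizing f with
  | zero => rfl
  | succ j ih =>
    rw [Function.iterate_succ_apply', integral_mul_lap hf (contDiff_iterate_lap hg j)
      (hasCompactSupport_iterate_lap hgc j), ih (contDiff_lap hf), Function.iterate_succ_apply]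

theorem fderiv_comp_norm_sq_add {h h' : ℝ → ℝ} {ε : ℝ} (hε : 0 < ε)
    (hh : ∀ s, 0 < s → HasDerivAt h (h' s) s) (x v : EuclideanSpace ℝ (Fin n)) :
    fderiv ℝ (fun y => h (‖y‖ ^ 2 + ε)) x v = h' (‖x‖ ^ 2 + ε) * (2 * inner ℝ x v) := by
  have h1 : HasFDerivAt (fun y : EuclideanSpace ℝ (Fin n) => ‖y‖ ^ 2 + ε)
      (2 • (innerSL ℝ x)) x := (hasStrictFDerivAt_norm_sq x).hasFDerivAt.add_const ε
  have h2 := (hh (‖x‖ ^ 2 + ε) (by positivity)).comp_hasFDerivAt x h1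
  rw [HasFDerivAt.fderiv (f := fun y => h (‖y‖ ^ 2 + ε)) h2]
  simp

/-- The Laplacian of a smooth function of `‖x‖ ^ 2 + ε`. -/
theorem lap_comp_norm_sq_add {h h' h'' : ℝ → ℝ} {ε : ℝ} (hε : 0 < ε)
    (hh : ∀ s, 0 < s → HasDerivAt h (h' s) s) (hh' : ∀ s, 0 < s → HasDerivAt h' (h'' s) s)
    (x : EuclideanSpace ℝ (Fin n)) :
    lap (fun y => h (‖y‖ ^ 2 + ε)) x =
      4 * ‖x‖ ^ 2 * h'' (‖x‖ ^ 2 + ε) + 2 * n * h' (‖x‖ ^ 2 + ε) := by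
  have hs : 0 < ‖x‖ ^ 2 + ε := by positivity
  have key (i : Fin n) : fderiv ℝ (fun y => fderiv ℝ (fun y => h (‖y‖ ^ 2 + ε)) y
      (EuclideanSpace.single i 1)) x (EuclideanSpace.single i 1) =
      4 * h'' (‖x‖ ^ 2 + ε) * x i ^ 2 + 2 * h' (‖x‖ ^ 2 + ε) := by
    have e : (fun y => fderiv ℝ (fun y => h (‖y‖ ^ 2 + ε)) y (EuclideanSpace.single i 1)) =
        fun y : EuclideanSpace ℝ (Fin n) => h' (‖y‖ ^ 2 + ε) * (2 * y i) := by
      ext y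
      rw [fderiv_comp_norm_sq_add hε hh]
      simp [EuclideanSpace.inner_single_right]
    have d1 : DifferentiableAt ℝ (fun y : EuclideanSpace ℝ (Fin n) => h' (‖y‖ ^ 2 + ε)) x :=
      ((hh' _ hs).differentiableAt).comp x
        ((contDiff_norm_sq ℝ (n := 1)).differentiable (by simp) x |>.add_const ε)
    have hp : HasFDerivAt (fun y : EuclideanSpace ℝ (Fin n) => 2 * y i)
        ((2 : ℝ) • (EuclideanSpace.proj i : EuclideanSpace ℝ (Fin n) →L[ℝ] ℝ)) x :=
      ((EuclideanSpace.proj i : EuclideanSpace ℝ (Fin n) →L[ℝ] ℝ).hasFDerivAt).const_mul 2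
    rw [e, fderiv_fun_mul d1 hp.differentiableAt]
    simp only [add_apply, smul_apply, fderiv_comp_norm_sq_add hε hh', hp.fderiv]
    simp [EuclideanSpace.inner_single_right]
    ring
  simp only [lap, key]
  rw [Finset.sum_add_distrib, ← Finset.mul_sum, EuclideanSpace.real_norm_sq_eq]
  simp
  ring

end Laplacian

section Coefficients

/-- `lap^[j + 1]` of `-log (‖x‖ ^ 2 + ε) / 2` on `ℝ^{2m}` is
`∑ k ≤ j + 1, lapLogCoeff m j k * ε ^ k * (‖x‖ ^ 2 + ε)⁻¹ ^ (j + 1 + k)`. -/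
noncomputable def lapLogCoeff (m j k : ℕ) : ℝ :=
  2 * 4 ^ j * (-1) ^ k * (j + 1).choose k * (j + k).factorial *
    ∏ i ∈ Finset.Ico k (j + 1), ((i : ℝ) + 1 - m)

theorem lapLogCoeff_succ_zero (m j : ℕ) :
    lapLogCoeff m (j + 1) 0 = 4 * (j + 1) * (j + 2 - m) * lapLogCoeff m j 0 := by
  simp only [lapLogCoeff]
  rw [Finset.prod_Ico_succ_top (by omega)]
  simp [Nat.factorial_succ]
  ring

theorem lapLogCoeff_succ_succ (m j k : ℕ) :
    lapLogCoeff m (j + 1) (k + 1) =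
      4 * (j + 1 + (k + 1)) * (j + 1 + (k + 1) + 1 - m) * lapLogCoeff m j (k + 1) -
        4 * (j + 1 + k) * (j + 1 + k + 1) * lapLogCoeff m j k := by
  simp only [lapLogCoeff]
  rcases lt_trichotomy k (j + 1) with hk | rfl | hk
  · rw [Finset.prod_Ico_succ_top (b := j + 1) (by omega),
      Finset.prod_eq_prod_Ico_succ_bot (a := k) hk, Nat.choose_succ_succ (j + 1) k]
    have hch : ((j + 1).choose (k + 1) : ℝ) * (k + 1) = (j + 1).choose k * (j + 1 - k) := by
      have := Nat.choose_succ_right_eq (j + 1) k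
      have h2 : ((j + 1 - k : ℕ) : ℝ) = j + 1 - k := by
        rw [Nat.cast_sub (by omega)]; push_cast; ring
      rw [← h2]; exact_mod_cast this
    have hf1 : (j + 1 + (k + 1)).factorial = (j + k + 2) * ((j + k + 1) * (j + k).factorial) := by
      rw [show j + 1 + (k + 1) = j + k + 1 + 1 by ring, Nat.factorial_succ, Nat.factorial_succ]
    have hf2 : (j + (k + 1)).factorial = (j + k + 1) * (j + k).factorial := by
      rw [show j + (k + 1) = j + k + 1 by ring, Nat.factorial_succ]
    rw [hf1, hf2]
    push_cast
    generalize (∏ i ∈ Finset.Ico (k + 1) (j + 1), ((i : ℝ) + 1 - m)) = P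
    linear_combination (-1) * (8 * 4 ^ j * (-1) ^ k * (j + k + 2) * (j + k + 1) *
      (j + k).factorial * P) * (-1) * hch
  · simp [Nat.choose_succ_self]
    rw [show j + 1 + (j + 1 + 1) = j + (j + 1) + 1 + 1 by ring, Nat.factorial_succ,
      Nat.factorial_succ]
    push_cast
    ring
  · simp [Nat.choose_eq_zero_of_lt hk, Nat.choose_eq_zero_of_lt (show j + 1 < k + 1 by omega),
      Nat.choose_eq_zero_of_lt (show j + 1 + 1 < k + 1 by omega)]

theorem lapLogCoeff_eq_zero_of_le {p k : ℕ} (hk : k ≤ p) : lapLogCoeff (p + 1) p k = 0 := by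
  rw [lapLogCoeff, Finset.prod_eq_zero (Finset.mem_Ico.2 ⟨hk, Nat.lt_succ_self p⟩) (by simp),
    mul_zero]

theorem lapLogCoeff_top (p : ℕ) :
    lapLogCoeff (p + 1) p (p + 1) = (-1) ^ (p + 1) * 2 ^ (2 * p + 1) * (2 * p + 1).factorial := by
  simp [lapLogCoeff, show p + (p + 1) = 2 * p + 1 by ring, pow_succ, pow_mul]
  norm_num
  ring_nf
  simp

end Coefficients

section Regularization

theorem hasDerivAt_inv_pow {s : ℝ} (hs : 0 < s) (k : ℕ) :
    HasDerivAt (fun s : ℝ => s⁻¹ ^ k) (-k * s⁻¹ ^ (k + 1)) s := by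
  refine ((hasDerivAt_inv hs.ne').fun_pow k).congr_deriv ?_
  rcases k with _ | k
  · simp
  · simp [pow_succ]
    ring

theorem lap_sum_inv_pow {m : ℕ} {ε : ℝ} (hε : 0 < ε) (c : ℕ → ℝ) (N : ℕ) (e : ℕ → ℕ)
    (x : EuclideanSpace ℝ (Fin (2 * m))) :
    lap (fun y => ∑ k ∈ Finset.range N, c k * (‖y‖ ^ 2 + ε)⁻¹ ^ e k) x =
      ∑ k ∈ Finset.range N, (4 * e k * (e k + 1 - m) * c k * (‖x‖ ^ 2 + ε)⁻¹ ^ (e k + 1) -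
        4 * e k * (e k + 1) * c k * ε * (‖x‖ ^ 2 + ε)⁻¹ ^ (e k + 2)) := by
  have hs : ‖x‖ ^ 2 + ε ≠ 0 := by positivity
  rw [lap_comp_norm_sq_add (h := fun s => ∑ k ∈ Finset.range N, c k * s⁻¹ ^ e k)
    (h' := fun s => ∑ k ∈ Finset.range N, c k * (-e k * s⁻¹ ^ (e k + 1)))
    (h'' := fun s => ∑ k ∈ Finset.range N, c k * (-e k * (-(e k + 1 : ℕ) * s⁻¹ ^ (e k + 1 + 1))))
    hε (fun s hs => .fun_sum fun k _ => (hasDerivAt_inv_pow hs _).const_mul _)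
    (fun s hs => .fun_sum fun k _ => ((hasDerivAt_inv_pow hs _).const_mul _).const_mul _),
    Finset.mul_sum, Finset.mul_sum, ← Finset.sum_add_distrib]
  refine Finset.sum_congr rfl fun k _ => ?_
  have h1 : ‖x‖ ^ 2 * (‖x‖ ^ 2 + ε)⁻¹ ^ (e k + 2) =
      (‖x‖ ^ 2 + ε)⁻¹ ^ (e k + 1) - ε * (‖x‖ ^ 2 + ε)⁻¹ ^ (e k + 2) := by
    rw [pow_succ _ (e k + 1)]
    field_simp
    ring
  push_cast
  linear_combination (4 * e k * (e k + 1) * c k) * h1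

theorem lap_log_norm_sq_add {m : ℕ} {ε : ℝ} (hε : 0 < ε) :
    lap (fun y : EuclideanSpace ℝ (Fin (2 * m)) => -(1 / 2) * Real.log (‖y‖ ^ 2 + ε)) =
      fun x => (2 - 2 * m) * (‖x‖ ^ 2 + ε)⁻¹ - 2 * ε * (‖x‖ ^ 2 + ε)⁻¹ ^ 2 := by
  ext x
  have hs : ‖x‖ ^ 2 + ε ≠ 0 := by positivity
  rw [lap_comp_norm_sq_add (h := fun s => -(1 / 2) * Real.log s)
    (h' := fun s => -(1 / 2) * s⁻¹) (h'' := fun s => -(1 / 2) * -(s ^ 2)⁻¹) hε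
    (fun s hs => (Real.hasDerivAt_log hs.ne').const_mul _)
    (fun s hs => (hasDerivAt_inv hs.ne').const_mul _)]
  push_cast
  field_simp
  ring

theorem iterate_lap_log_norm_sq_add {m : ℕ} {ε : ℝ} (hε : 0 < ε) (j : ℕ) :
    lap^[j + 1] (fun y : EuclideanSpace ℝ (Fin (2 * m)) =>
        -(1 / 2) * Real.log (‖y‖ ^ 2 + ε)) =
      fun x => ∑ k ∈ Finset.range (j + 2),
        lapLogCoeff m j k * ε ^ k * (‖x‖ ^ 2 + ε)⁻¹ ^ (j + 1 + k) := by
  induction j with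
  | zero =>
    rw [zero_add, Function.iterate_one, lap_log_norm_sq_add hε]
    ext x
    simp [Finset.sum_range_succ, lapLogCoeff]
    ring
  | succ j ih =>
    rw [Function.iterate_succ_apply', ih]
    ext x
    rw [lap_sum_inv_pow hε]
    generalize (‖x‖ ^ 2 + ε)⁻¹ = u
    rw [Finset.sum_sub_distrib, Finset.sum_range_succ' _ (j + 2),
      ← add_zero (∑ k ∈ Finset.range (j + 2), 4 * _ * _ * _ * _)]
    have h0 : (0 : ℝ) = 4 * (j + 1 + (j + 2 : ℕ)) * (j + 1 + (j + 2 : ℕ) + 1 - m) *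
        (lapLogCoeff m j (j + 2) * ε ^ (j + 2)) * u ^ (j + 1 + (j + 2) + 1) := by
      simp [lapLogCoeff]
    have h1 := Finset.sum_range_succ' (fun k : ℕ => 4 * ((j : ℝ) + 1 + k) *
      (j + 1 + k + 1 - m) * (lapLogCoeff m j k * ε ^ k) * u ^ (j + 1 + k + 1)) (j + 2)
    rw [Finset.sum_range_succ, ← h0] at h1
    push_cast at h1 ⊢
    rw [h1, add_sub_right_comm, ← Finset.sum_sub_distrib]
    congr 1
    · refine Finset.sum_congr rfl fun k _ => ?_
      rw [lapLogCoeff_succ_succ]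
      ring
    · rw [lapLogCoeff_succ_zero]
      ring

/-- The regularization `-log (‖x‖ ^ 2 + ε) / 2` of `-log ‖x‖` has a polyharmonic derivative of
critical order which is a multiple of a Poisson type kernel. -/
theorem iterate_lap_log_norm_sq_add_critical {p : ℕ} {ε : ℝ} (hε : 0 < ε) :
    lap^[p + 1] (fun y : EuclideanSpace ℝ (Fin (2 * (p + 1))) =>
        -(1 / 2) * Real.log (‖y‖ ^ 2 + ε)) =
      fun x => (-1) ^ (p + 1) * 2 ^ (2 * p + 1) * (2 * p + 1).factorial *
        ε ^ (p + 1) * (‖x‖ ^ 2 + ε)⁻¹ ^ (2 * (p + 1)) := by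
  rw [iterate_lap_log_norm_sq_add hε]
  ext x
  rw [Finset.sum_range_succ, Finset.sum_eq_zero, zero_add, lapLogCoeff_top]
  · ring_nf
  · intro k hk
    rw [lapLogCoeff_eq_zero_of_le (by simpa [Nat.lt_succ_iff] using hk)]
    simp

theorem contDiff_log_norm_sq_add {n : ℕ} {ε : ℝ} (hε : 0 < ε) :
    ContDiff ℝ (⊤ : ℕ∞)
      (fun y : EuclideanSpace ℝ (Fin n) => -(1 / 2) * Real.log (‖y‖ ^ 2 + ε)) :=
  contDiff_const.mul (((contDiff_norm_sq ℝ).add contDiff_const).log fun x => by positivity)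

end Regularization

section Kernel

theorem hasDerivAt_pow_div_one_add_sq_pow (a b : ℕ) (r : ℝ) :
    HasDerivAt (fun r : ℝ => r ^ (a + 1) / (1 + r ^ 2) ^ (b + 1))
      ((a + 1) * (r ^ a / (1 + r ^ 2) ^ (b + 1)) -
        2 * (b + 1) * (r ^ (a + 2) / (1 + r ^ 2) ^ (b + 2))) r := by
  have h0 : 1 + r ^ 2 ≠ 0 := by positivity
  have h1 : HasDerivAt (fun r : ℝ => 1 + r ^ 2) (2 * r) r := by
    simpa using (hasDerivAt_pow 2 r).const_add 1
  refine ((hasDerivAt_pow (a + 1) r).div (h1.fun_pow (b + 1)) (by positivity)).congr_deriv ?_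
  push_cast
  field_simp
  ring

theorem tendsto_pow_div_one_add_sq_pow {a b : ℕ} (h : a + 1 ≤ 2 * b) :
    Tendsto (fun r : ℝ => r ^ a / (1 + r ^ 2) ^ b) atTop (𝓝 0) := by
  refine squeeze_zero' (g := fun r : ℝ => r⁻¹) ?_ ?_ tendsto_inv_atTop_zero
  · filter_upwards [eventually_ge_atTop 0] with r hr
    positivity
  · filter_upwards [eventually_ge_atTop 1] with r hr
    rw [div_le_iff₀ (by positivity), inv_mul_eq_div, le_div_iff₀ (by positivity), ← pow_succ]
    calc r ^ (a + 1) ≤ r ^ (2 * b) := pow_le_pow_right₀ hr h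
      _ = (r ^ 2) ^ b := pow_mul _ _ _
      _ ≤ (1 + r ^ 2) ^ b := by gcongr; linarith

theorem integral_pow_div_one_add_sq_pow (a c : ℕ) :
    IntegrableOn (fun r : ℝ => r ^ (2 * a + 1) / (1 + r ^ 2) ^ (a + c + 2)) (Ioi 0) ∧
      ∫ r in Ioi (0 : ℝ), r ^ (2 * a + 1) / (1 + r ^ 2) ^ (a + c + 2) =
        (a.factorial * c.factorial / (2 * (a + c + 1).factorial) : ℝ) := by
  induction a with
  | zero =>
    have hd (r : ℝ) : HasDerivAt (fun r : ℝ => -(1 / (2 * (c + 1))) * (1 / (1 + r ^ 2) ^ (c + 1)))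
        (r ^ (2 * 0 + 1) / (1 + r ^ 2) ^ (0 + c + 2)) r := by
      have h0 : 1 + r ^ 2 ≠ 0 := by positivity
      have h1 : HasDerivAt (fun r : ℝ => 1 + r ^ 2) (2 * r) r := by
        simpa using (hasDerivAt_pow 2 r).const_add 1
      refine (((hasDerivAt_const r (1 : ℝ)).div (h1.fun_pow (c + 1))
        (by positivity)).const_mul _).congr_deriv ?_
      push_cast
      simp only [zero_add, pow_one]
      field_simp
      ring
    have hl : Tendsto (fun r : ℝ => -(1 / (2 * (c + 1))) * (1 / (1 + r ^ 2) ^ (c + 1)))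
        atTop (𝓝 (-(1 / (2 * ((c : ℝ) + 1))) * 0)) := by
      refine Tendsto.const_mul _ ?_
      simpa using tendsto_pow_div_one_add_sq_pow (a := 0) (b := c + 1) (by omega)
    have hn : ∀ r ∈ Ioi (0 : ℝ), 0 ≤ r ^ (2 * 0 + 1) / (1 + r ^ 2) ^ (0 + c + 2) := by
      intro r (hr : 0 < r)
      positivity
    refine ⟨integrableOn_Ioi_deriv_of_nonneg' (fun r _ => hd r) hn hl, ?_⟩
    rw [integral_Ioi_of_hasDerivAt_of_nonneg' (fun r _ => hd r) hn hl, zero_add,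
      Nat.factorial_succ]
    push_cast
    have := Nat.factorial_ne_zero c
    field_simp
    simp
  | succ a ih =>
    obtain ⟨hi, hv⟩ := ih
    have hi' : IntegrableOn (fun r : ℝ => r ^ (2 * (a + 1) + 1) / (1 + r ^ 2) ^ (a + 1 + c + 2))
        (Ioi 0) := by
      refine hi.mono' ?_ ?_
      · refine Continuous.aestronglyMeasurable ?_
        exact (continuous_pow _).div (by fun_prop) fun r => by positivity
      · refine (ae_restrict_mem measurableSet_Ioi).mono fun r (hr : 0 < r) => ?_
        rw [Real.norm_of_nonneg (by positivity), div_le_div_iff₀ (by positivity) (by positivity),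
          show 2 * (a + 1) + 1 = 2 * a + 1 + 2 by ring,
          show a + 1 + c + 2 = a + c + 2 + 1 by ring, pow_add _ _ 2,
          pow_succ (1 + r ^ 2) (a + c + 2)]
        have : 0 ≤ r ^ (2 * a + 1) * (1 + r ^ 2) ^ (a + c + 2) := by positivity
        nlinarith
    refine ⟨hi', ?_⟩
    have hd (r : ℝ) := hasDerivAt_pow_div_one_add_sq_pow (2 * a + 1) (a + c + 1) r
    rw [show 2 * a + 1 + 2 = 2 * (a + 1) + 1 by ring, show a + c + 1 + 1 = a + c + 2 by ring,
      show a + c + 1 + 2 = a + 1 + c + 2 by ring] at hd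
    have key := integral_Ioi_of_hasDerivAt_of_tendsto' (a := 0) (fun r _ => hd r)
      ((hi.const_mul _).sub (hi'.const_mul _))
      (tendsto_pow_div_one_add_sq_pow (by omega))
    rw [integral_sub (hi.const_mul _) (hi'.const_mul _), integral_const_mul, integral_const_mul,
      hv] at key
    rw [show a + 1 + c + 1 = a + c + 1 + 1 by ring, Nat.factorial_succ, Nat.factorial_succ]
    have h1 := Nat.factorial_ne_zero (a + c + 1)
    have h2 : (0 : ℝ) < a + c + 1 + 1 := by positivity
    push_cast at key ⊢
    simp at key
    field_simp at key ⊢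
    linarith

theorem integrable_inv_one_add_norm_sq_pow (p : ℕ) :
    Integrable fun x : EuclideanSpace ℝ (Fin (2 * (p + 1))) =>
      (‖x‖ ^ 2 + 1)⁻¹ ^ (2 * (p + 1)) := by
  rw [integrable_fun_norm_addHaar volume (f := fun r => (r ^ 2 + 1)⁻¹ ^ (2 * (p + 1)))]
  refine (integral_pow_div_one_add_sq_pow p p).1.congr_fun (fun r _ => ?_) measurableSet_Ioi
  simp [div_eq_mul_inv, add_comm, show 2 * (p + 1) - 1 = 2 * p + 1 by omega]
  ring_nf
  simp

theorem integral_inv_one_add_norm_sq_pow (p : ℕ) :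
    ∫ x : EuclideanSpace ℝ (Fin (2 * (p + 1))), (‖x‖ ^ 2 + 1)⁻¹ ^ (2 * (p + 1)) =
      Real.pi ^ (p + 1) * p.factorial / (2 * p + 1).factorial := by
  rw [integral_fun_norm_addHaar volume (fun r => (r ^ 2 + 1)⁻¹ ^ (2 * (p + 1)))]
  have h : ∫ y in Ioi (0 : ℝ),
      y ^ (Module.finrank ℝ (EuclideanSpace ℝ (Fin (2 * (p + 1)))) - 1) •
        (y ^ 2 + 1)⁻¹ ^ (2 * (p + 1)) =
      (p.factorial * p.factorial / (2 * (p + p + 1).factorial) : ℝ) := by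
    rw [← (integral_pow_div_one_add_sq_pow p p).2]
    refine setIntegral_congr_fun measurableSet_Ioi fun r _ => ?_
    simp [div_eq_mul_inv, add_comm, show 2 * (p + 1) - 1 = 2 * p + 1 by omega]
    ring_nf
    simp
  rw [h, Measure.real, InnerProductSpace.volume_ball_of_dim_even (k := p + 1) (by simp)]
  have h1 := Nat.factorial_ne_zero p
  have h2 := Nat.factorial_ne_zero (2 * p + 1)
  simp only [finrank_euclideanSpace, Fintype.card_fin, ENNReal.ofReal_one, one_pow, one_mul,
    smul_eq_mul, nsmul_eq_mul, ← two_mul, Nat.factorial_succ p]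
  rw [ENNReal.toReal_ofReal (by positivity)]
  push_cast
  field_simp

/-- The kernels `ε ^ m / (‖x‖ ^ 2 + ε) ^ (2 m)` are an approximate identity on `ℝ^{2m}`. -/
theorem tendsto_integral_kernel_mul {p : ℕ} {φ : EuclideanSpace ℝ (Fin (2 * (p + 1))) → ℝ}
    (hφ : Continuous φ) (hc : HasCompactSupport φ) :
    Tendsto (fun δ : ℝ => ∫ x, (δ ^ 2) ^ (p + 1) * (‖x‖ ^ 2 + δ ^ 2)⁻¹ ^ (2 * (p + 1)) * φ x)
      (𝓝[>] 0) (𝓝 (Real.pi ^ (p + 1) * p.factorial / (2 * p + 1).factorial * φ 0)) := by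
  obtain ⟨C, hC⟩ := hφ.bounded_above_of_compact_support hc
  rw [← integral_inv_one_add_norm_sq_pow, ← integral_mul_const]
  have hlim : Tendsto (fun δ : ℝ => ∫ x : EuclideanSpace ℝ (Fin (2 * (p + 1))),
      (‖x‖ ^ 2 + 1)⁻¹ ^ (2 * (p + 1)) * φ (δ • x)) (𝓝[>] 0)
      (𝓝 (∫ x : EuclideanSpace ℝ (Fin (2 * (p + 1))),
        (‖x‖ ^ 2 + 1)⁻¹ ^ (2 * (p + 1)) * φ 0)) := by
    refine tendsto_integral_filter_of_dominated_convergence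
      (fun x => (‖x‖ ^ 2 + 1)⁻¹ ^ (2 * (p + 1)) * C) (.of_forall fun δ => ?_)
      (.of_forall fun δ => .of_forall fun x => ?_)
      ((integrable_inv_one_add_norm_sq_pow p).mul_const C) (.of_forall fun x => ?_)
    · exact (integrable_inv_one_add_norm_sq_pow p).aestronglyMeasurable.mul
        (by fun_prop : Continuous fun x => φ (δ • x)).aestronglyMeasurable
    · rw [norm_mul, Real.norm_of_nonneg (by positivity)]
      gcongr
      exact hC _
    · refine Tendsto.const_mul _ ((?_ : Tendsto (fun δ : ℝ => φ (δ • x)) (𝓝 0) _).mono_left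
        nhdsWithin_le_nhds)
      exact (by fun_prop : Continuous fun δ : ℝ => φ (δ • x)).tendsto' _ _ (by simp)
  refine hlim.congr' ?_
  filter_upwards [self_mem_nhdsWithin] with δ (hδ : 0 < δ)
  have hscale := Measure.integral_comp_smul_of_nonneg volume
    (fun x : EuclideanSpace ℝ (Fin (2 * (p + 1))) =>
      (δ ^ 2) ^ (p + 1) * (‖x‖ ^ 2 + δ ^ 2)⁻¹ ^ (2 * (p + 1)) * φ x) δ (hR := hδ.le)
  rw [smul_eq_mul, eq_inv_mul_iff_mul_eq₀ (by positivity), ← integral_const_mul] at hscale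
  rw [← hscale]
  refine integral_congr_ae (.of_forall fun x => ?_)
  have h1 : ‖δ • x‖ ^ 2 + δ ^ 2 = δ ^ 2 * (‖x‖ ^ 2 + 1) := by
    rw [norm_smul, mul_pow, Real.norm_eq_abs, sq_abs]; ring
  simp only [h1, finrank_euclideanSpace, Fintype.card_fin, mul_inv, mul_pow, ← pow_mul, inv_pow]
  field_simp
  ring

end Kernel

section Limit

theorem integrableOn_log_norm_ball {n : ℕ} (hn : 1 ≤ n) (R : ℝ) :
    IntegrableOn (fun x : EuclideanSpace ℝ (Fin n) => Real.log ‖x‖) (ball 0 R) := by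
  have : Nontrivial (EuclideanSpace ℝ (Fin n)) :=
    Module.nontrivial_of_finrank_pos (R := ℝ) (by simp; omega)
  rw [integrableOn_fun_norm_addHaar volume (f := Real.log)]
  rcases le_total R 0 with hR | hR
  · simp [Ioo_eq_empty_of_le hR]
  have h : IntegrableOn Real.log (Ioo 0 R) :=
    ((intervalIntegrable_iff_integrableOn_Ioo_of_le hR).1 intervalIntegral.intervalIntegrable_log')
  refine h.bdd_mul (c := R ^ (n - 1)) (by fun_prop) ?_
  refine (ae_restrict_mem measurableSet_Ioo).mono fun r hr => ?_
  rw [Real.norm_of_nonneg (pow_nonneg hr.1.le _)]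
  simpa using pow_le_pow_left₀ hr.1.le hr.2.le _

theorem abs_log_norm_sq_add_le {t ε R : ℝ} (ht : 0 < t) (htR : t ≤ R) (hε : 0 ≤ ε) (hε1 : ε ≤ 1) :
    |-(1 / 2) * Real.log (t ^ 2 + ε)| ≤ |Real.log t| + Real.log (R ^ 2 + 1) := by
  have h1 : Real.log (t ^ 2) ≤ Real.log (t ^ 2 + ε) := Real.log_le_log (by positivity) (by linarith)
  have h2 : Real.log (t ^ 2 + ε) ≤ Real.log (R ^ 2 + 1) :=
    Real.log_le_log (by positivity) (by gcongr)
  have h3 : 0 ≤ Real.log (R ^ 2 + 1) := Real.log_nonneg (by nlinarith)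
  rw [Real.log_pow] at h1
  push_cast at h1
  have h4 := neg_abs_le (Real.log t)
  rw [abs_le]
  constructor <;> linarith [abs_nonneg (Real.log t)]

theorem tendsto_integral_log_mul {n : ℕ} (hn : 1 ≤ n) {ψ : EuclideanSpace ℝ (Fin n) → ℝ}
    (hψ : Continuous ψ) (hc : HasCompactSupport ψ) :
    Tendsto (fun δ : ℝ => ∫ x, -(1 / 2) * Real.log (‖x‖ ^ 2 + δ ^ 2) * ψ x)
      (𝓝[>] 0) (𝓝 (∫ x, Real.log (1 / ‖x‖) * ψ x)) := by
  have : Nontrivial (EuclideanSpace ℝ (Fin n)) :=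
    Module.nontrivial_of_finrank_pos (R := ℝ) (by simp; omega)
  obtain ⟨C, hC⟩ := hψ.bounded_above_of_compact_support hc
  obtain ⟨R, hR⟩ := hc.isCompact.isBounded.subset_ball 0
  have hne : ∀ᵐ x : EuclideanSpace ℝ (Fin n), x ≠ 0 := by
    simp [ae_iff]
  have hint : IntegrableOn (fun x : EuclideanSpace ℝ (Fin n) =>
      (|Real.log ‖x‖| + Real.log (R ^ 2 + 1)) * C) (ball 0 R) :=
    ((integrableOn_log_norm_ball hn R).abs.add
      (integrableOn_const measure_ball_lt_top.ne)).mul_const C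
  refine tendsto_integral_filter_of_dominated_convergence
    ((ball 0 R).indicator fun x => (|Real.log ‖x‖| + Real.log (R ^ 2 + 1)) * C) ?_ ?_
    (hint.integrable_indicator measurableSet_ball) ?_
  · filter_upwards [self_mem_nhdsWithin] with δ (hδ : 0 < δ)
    exact ((contDiff_log_norm_sq_add (by positivity)).continuous.mul hψ).aestronglyMeasurable
  · filter_upwards [Ioo_mem_nhdsGT one_pos] with δ hδ
    filter_upwards [hne] with x hx
    by_cases hxR : x ∈ ball (0 : EuclideanSpace ℝ (Fin n)) R
    · rw [indicator_of_mem hxR, norm_mul]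
      have hx' := mem_ball_zero_iff.1 hxR
      gcongr
      · exact (abs_nonneg _).trans (abs_log_norm_sq_add_le (norm_pos_iff.2 hx) hx'.le
          (sq_nonneg δ) (pow_le_one₀ hδ.1.le hδ.2.le))
      · exact abs_log_norm_sq_add_le (norm_pos_iff.2 hx) hx'.le
          (sq_nonneg δ) (pow_le_one₀ hδ.1.le hδ.2.le)
      · exact hC x
    · rw [indicator_of_notMem hxR, image_eq_zero_of_notMem_tsupport fun h => hxR (hR h)]
      simp
  · filter_upwards [hne] with x hx
    refine Tendsto.mul_const _ (Tendsto.mono_left ?_ nhdsWithin_le_nhds)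
    have hx' : ‖x‖ ^ 2 + (0 : ℝ) ^ 2 ≠ 0 := by simpa using hx
    have hct : ContinuousAt (fun δ : ℝ => -(1 / 2) * Real.log (‖x‖ ^ 2 + δ ^ 2)) 0 :=
      continuousAt_const.mul (ContinuousAt.log (by fun_prop) hx')
    convert hct.tendsto using 2
    simp [Real.log_pow]

end Limit

theorem stmt_16 (m : ℕ) (hm : 1 ≤ m)
    (φ : EuclideanSpace ℝ (Fin (2*m)) → ℝ)
    (hφ : ContDiff ℝ (⊤ : ℕ∞) φ) (hc : HasCompactSupport φ) :
    (-1 : ℝ)^m *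
        (∫ x : EuclideanSpace ℝ (Fin (2*m)), Real.log (1 / ‖x‖) * lap^[m] φ x) =
      2^(2*m-1) * Real.pi^m * (m-1).factorial * φ 0 := by
  obtain ⟨p, rfl⟩ : ∃ p, m = p + 1 := ⟨m - 1, by omega⟩
  have h1 := (tendsto_integral_log_mul (by omega) (contDiff_iterate_lap hφ (p + 1)).continuous
    (hasCompactSupport_iterate_lap hc (p + 1))).const_mul ((-1 : ℝ) ^ (p + 1))
  have h2 := (tendsto_integral_kernel_mul hφ.continuous hc).const_mul
    ((2 : ℝ) ^ (2 * p + 1) * (2 * p + 1).factorial)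
  refine (tendsto_nhds_unique (h1.congr' ?_) h2).trans ?_
  · filter_upwards [self_mem_nhdsWithin] with δ (hδ : 0 < δ)
    have hδ2 : 0 < δ ^ 2 := by positivity
    rw [integral_mul_iterate_lap (contDiff_log_norm_sq_add hδ2) hφ hc,
      iterate_lap_log_norm_sq_add_critical hδ2, ← integral_const_mul, ← integral_const_mul]
    refine integral_congr_ae (.of_forall fun x => ?_)
    have hsign : (-1 : ℝ) ^ (p + 1) * (-1) ^ (p + 1) = 1 := by
      rw [← mul_pow]; simp
    linear_combination (2 ^ (2 * p + 1) * (2 * p + 1).factorial * (δ ^ 2) ^ (p + 1) *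
      (‖x‖ ^ 2 + δ ^ 2)⁻¹ ^ (2 * (p + 1)) * φ x) * hsign
  · have := Nat.factorial_ne_zero (2 * p + 1)
    rw [show 2 * (p + 1) - 1 = 2 * p + 1 by omega, Nat.add_sub_cancel]
    field_simp
end

section
/- For every integer m ≥ 1 and every point a ∈ ℝ^{2m}, the function h(x) := log(1/|x−a|) is smooth on ℝ^{2m}∖{a} and satisfies Δ^m h = 0 at every point of ℝ^{2m}∖{a}. -/
open MeasureTheory Metric Filter Set
open scoped ENNReal Topology

lemma hasFDerivAt_norm_sub_sq {E : Type*} [NormedAddCommGroup E] [InnerProductSpace ℝ E]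
    (a y : E) : HasFDerivAt (fun z => ‖z - a‖ ^ 2) (2 • innerSL ℝ (y - a)) y := by
  simpa using ((hasFDerivAt_id y).sub_const a).norm_sq

/-- The Laplacian of a radial function, written as a function of the squared radius. -/
lemma lap_radial {n : ℕ} (a : EuclideanSpace ℝ (Fin n)) {f : EuclideanSpace ℝ (Fin n) → ℝ}
    {g g₁ g₂ : ℝ → ℝ} (hg : ∀ t, 0 < t → HasDerivAt g (g₁ t) t)
    (hg₁ : ∀ t, 0 < t → HasDerivAt g₁ (g₂ t) t)
    (hf : ∀ x, x ≠ a → f x = g (‖x - a‖ ^ 2))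
    {x : EuclideanSpace ℝ (Fin n)} (hx : x ≠ a) :
    lap f x = 4 * ‖x - a‖ ^ 2 * g₂ (‖x - a‖ ^ 2) + 2 * n * g₁ (‖x - a‖ ^ 2) := by
  have hpos : ∀ y, y ≠ a → 0 < ‖y - a‖ ^ 2 := fun y hy =>
    pow_pos (norm_pos_iff.2 (sub_ne_zero.2 hy)) 2
  have first : ∀ (i : Fin n) y, y ≠ a → fderiv ℝ f y (EuclideanSpace.single i 1)
      = g₁ (‖y - a‖ ^ 2) * (2 * (y i - a i)) := by
    intro i y hy
    have h := (hg _ (hpos y hy)).comp_hasFDerivAt y (hasFDerivAt_norm_sub_sq a y)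
    have he : f =ᶠ[𝓝 y] g ∘ fun z => ‖z - a‖ ^ 2 := by
      filter_upwards [isOpen_ne.mem_nhds hy] with z hz using hf z hz
    rw [(h.congr_of_eventuallyEq he).fderiv]
    simp [EuclideanSpace.inner_single_right]
  have second : ∀ i : Fin n,
      fderiv ℝ (fun y => fderiv ℝ f y (EuclideanSpace.single i 1)) x (EuclideanSpace.single i 1)
      = 4 * g₂ (‖x - a‖ ^ 2) * (x i - a i) ^ 2 + 2 * g₁ (‖x - a‖ ^ 2) := by
    intro i
    have h := (hg₁ _ (hpos x hx)).comp_hasFDerivAt x (hasFDerivAt_norm_sub_sq a x)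
    have hc : HasFDerivAt (fun y : EuclideanSpace ℝ (Fin n) => 2 * (y i - a i))
        ((2 : ℝ) • (EuclideanSpace.proj i : EuclideanSpace ℝ (Fin n) →L[ℝ] ℝ)) x :=
      (((EuclideanSpace.proj i : EuclideanSpace ℝ (Fin n) →L[ℝ] ℝ).hasFDerivAt).sub_const
        (a i)).const_mul 2
    have he : (fun y => fderiv ℝ f y (EuclideanSpace.single i 1)) =ᶠ[𝓝 x]
        fun y => (g₁ ∘ fun z => ‖z - a‖ ^ 2) y * (2 * (y i - a i)) := by
      filter_upwards [isOpen_ne.mem_nhds hx] with z hz using first i z hz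
    rw [((h.mul hc).congr_of_eventuallyEq he).fderiv]
    simp [EuclideanSpace.inner_single_right]
    ring
  have hnorm : ‖x - a‖ ^ 2 = ∑ i, (x i - a i) ^ 2 := by
    simp [EuclideanSpace.real_norm_sq_eq]
  simp only [lap, second, Finset.sum_add_distrib, ← Finset.mul_sum, ← hnorm]
  simp
  ring

lemma log_one_div_norm_eq {E : Type*} [NormedAddCommGroup E] (v : E) :
    Real.log (1 / ‖v‖) = -(1 / 2) * Real.log (‖v‖ ^ 2) := by
  rw [one_div, Real.log_inv, Real.log_pow]
  push_cast
  ring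

lemma hasDerivAt_const_mul_inv_pow (c : ℝ) (k : ℕ) {t : ℝ} (ht : 0 < t) :
    HasDerivAt (fun t : ℝ => c * t⁻¹ ^ k) (-(c * k) * t⁻¹ ^ (k + 1)) t := by
  convert! ((hasDerivAt_inv ht.ne').pow k).const_mul c using 1
  cases k with
  | zero => simp
  | succ k =>
    simp only [Nat.add_sub_cancel, inv_pow]
    field_simp
    ring

lemma lap_const_mul_inv_pow {n : ℕ} (a : EuclideanSpace ℝ (Fin n))
    {f : EuclideanSpace ℝ (Fin n) → ℝ} {c : ℝ} {k : ℕ}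
    (hf : ∀ x, x ≠ a → f x = c * (‖x - a‖ ^ 2)⁻¹ ^ k)
    {x : EuclideanSpace ℝ (Fin n)} (hx : x ≠ a) :
    lap f x = c * (2 * k * (2 * k + 2 - n)) * (‖x - a‖ ^ 2)⁻¹ ^ (k + 1) := by
  rw [lap_radial a (fun t ht => hasDerivAt_const_mul_inv_pow c k ht)
    (fun t ht => hasDerivAt_const_mul_inv_pow _ (k + 1) ht) hf hx]
  have : ‖x - a‖ ≠ 0 := norm_ne_zero_iff.2 (sub_ne_zero.2 hx)
  simp only [inv_pow]
  push_cast
  field_simp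
  ring

lemma lap_log_one_div_norm_sub {n : ℕ} (a : EuclideanSpace ℝ (Fin n))
    {x : EuclideanSpace ℝ (Fin n)} (hx : x ≠ a) :
    lap (fun x => Real.log (1 / ‖x - a‖)) x = (2 - n) * (‖x - a‖ ^ 2)⁻¹ ^ 1 := by
  have hlog : ∀ t : ℝ, 0 < t →
      HasDerivAt (fun t => -(1 / 2) * Real.log t) (-(1 / 2) * t⁻¹ ^ 1) t := fun t ht => by
    simpa using (Real.hasDerivAt_log ht.ne').const_mul (-(1 / 2) : ℝ)
  rw [lap_radial a hlog (fun t ht => hasDerivAt_const_mul_inv_pow _ 1 ht)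
    (fun x _ => log_one_div_norm_eq (x - a)) hx]
  have : ‖x - a‖ ≠ 0 := norm_ne_zero_iff.2 (sub_ne_zero.2 hx)
  simp only [inv_pow]
  push_cast
  field_simp
  ring

lemma lap_iterate_log_one_div_norm_sub {n : ℕ} (a : EuclideanSpace ℝ (Fin n)) (k : ℕ) :
    ∃ c : ℝ, ∀ x, x ≠ a → lap^[k + 1] (fun x => Real.log (1 / ‖x - a‖)) x
      = c * (2 * k + 2 - n) * (‖x - a‖ ^ 2)⁻¹ ^ (k + 1) := by
  induction k with
  | zero =>
    refine ⟨1, fun x hx => ?_⟩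
    simpa using lap_log_one_div_norm_sub a hx
  | succ k ih =>
    obtain ⟨c, hc⟩ := ih
    refine ⟨c * (2 * k + 2 - n) * (2 * (k + 1)), fun x hx => ?_⟩
    rw [Function.iterate_succ_apply', lap_const_mul_inv_pow a hc hx]
    push_cast
    ring

theorem stmt_17 (m : ℕ) (hm : 1 ≤ m) (a : EuclideanSpace ℝ (Fin (2*m))) :
    ContDiffOn ℝ (⊤ : ℕ∞)
      (fun x : EuclideanSpace ℝ (Fin (2*m)) => Real.log (1 / ‖x - a‖)) ({a}ᶜ) ∧
    ∀ x : EuclideanSpace ℝ (Fin (2*m)), x ≠ a →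
      lap^[m] (fun x => Real.log (1 / ‖x - a‖)) x = 0 := by
  constructor
  · simp only [log_one_div_norm_eq]
    intro x hx
    have h : ‖x - a‖ ^ 2 ≠ 0 := pow_ne_zero 2 (norm_ne_zero_iff.2 (sub_ne_zero.2 hx))
    exact (contDiffAt_const.mul
      (((contDiffAt_id.sub contDiffAt_const).norm_sq ℝ).log h)).contDiffWithinAt
  · intro x hx
    obtain ⟨k, rfl⟩ := Nat.exists_eq_add_of_le' hm
    obtain ⟨c, hc⟩ := lap_iterate_log_one_div_norm_sub a k
    rw [hc x hx]
    push_cast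
    ring
end
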